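/- Brahmagupta's formula: let A, B, C, D be four distinct concyclic points in the Euclidean plane ℝ² forming a convex cyclic quadrilateral in this order. Write a = dist A B, b = dist B C, c = dist C D, d = dist D A and p = (a + b + c + d)/2. Then the area of the quadrilateral, i.e., the 2-dimensional Lebesgue measure of the convex hull of {A, B, C, D}, equals √((p−a)(p−b)(p−c)(p−d)). -/

import Mathlib

open Real EuclideanGeometry Metric MeasureTheory

/-- The determinant of two vectors of the Euclidean plane. -/
def planeDet (u v : EuclideanSpace ℝ (Fin 2)) : ℝ := u 0 * v 1 - u 1 * v 0

theorem volume_standard_triangle_prod :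
    volume {p : ℝ × ℝ | 0 ≤ p.1 ∧ 0 ≤ p.2 ∧ p.1 + p.2 ≤ 1} = ENNReal.ofReal (1 / 2) := by
  have hmeas : MeasurableSet {p : ℝ × ℝ | 0 ≤ p.1 ∧ 0 ≤ p.2 ∧ p.1 + p.2 ≤ 1} := by
    measurability
  have hsection (x : ℝ) : volume (Prod.mk x ⁻¹' {p : ℝ × ℝ | 0 ≤ p.1 ∧ 0 ≤ p.2 ∧ p.1 + p.2 ≤ 1})
      = (Set.Icc (0 : ℝ) 1).indicator (fun x ↦ ENNReal.ofReal (1 - x)) x := by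
    by_cases hx : x ∈ Set.Icc (0 : ℝ) 1
    · have : Prod.mk x ⁻¹' {p : ℝ × ℝ | 0 ≤ p.1 ∧ 0 ≤ p.2 ∧ p.1 + p.2 ≤ 1}
          = Set.Icc 0 (1 - x) := by
        ext y
        simp only [Set.mem_preimage, Set.mem_ofPred_eq, Set.mem_Icc] at hx ⊢
        constructor
        · rintro ⟨-, h1, h2⟩
          exact ⟨h1, by linarith⟩
        · rintro ⟨h1, h2⟩
          exact ⟨hx.1, h1, by linarith⟩
      rw [this, Set.indicator_of_mem hx, Real.volume_Icc, sub_zero]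
    · have : Prod.mk x ⁻¹' {p : ℝ × ℝ | 0 ≤ p.1 ∧ 0 ≤ p.2 ∧ p.1 + p.2 ≤ 1} = ∅ := by
        ext y
        simp only [Set.mem_preimage, Set.mem_ofPred_eq, Set.mem_empty_iff_false, iff_false]
        rintro ⟨h0, h1, h2⟩
        exact hx ⟨h0, by linarith⟩
      rw [this, Set.indicator_of_notMem hx, measure_empty]
  rw [Measure.volume_eq_prod, Measure.prod_apply hmeas]
  simp_rw [hsection]
  rw [lintegral_indicator measurableSet_Icc, ← ofReal_integral_eq_lintegral_ofReal]
  · congr 1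
    rw [integral_Icc_eq_integral_Ioc, ← intervalIntegral.integral_of_le zero_le_one,
      intervalIntegral.integral_sub (by simp) (by simp)]
    norm_num
  · exact ContinuousOn.integrableOn_Icc (by fun_prop)
  · filter_upwards [ae_restrict_mem measurableSet_Icc] with x hx
    exact sub_nonneg.2 hx.2

theorem volume_standard_triangle :
    volume {x : EuclideanSpace ℝ (Fin 2) | 0 ≤ x 0 ∧ 0 ≤ x 1 ∧ x 0 + x 1 ≤ 1}
      = ENNReal.ofReal (1 / 2) := by
  have hmeas : MeasurableSet {p : ℝ × ℝ | 0 ≤ p.1 ∧ 0 ≤ p.2 ∧ p.1 + p.2 ≤ 1} := by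
    measurability
  rw [← volume_standard_triangle_prod]
  exact ((volume_preserving_finTwoArrow ℝ).comp
    (PiLp.volume_preserving_ofLp (Fin 2))).measure_preimage hmeas.nullMeasurableSet

theorem mem_convexHull_triple_iff {E : Type*} [AddCommGroup E] [Module ℝ E] {A B C x : E} :
    x ∈ convexHull ℝ {A, B, C} ↔
      ∃ s t : ℝ, 0 ≤ s ∧ 0 ≤ t ∧ s + t ≤ 1 ∧ x = A + (s • (B - A) + t • (C - A)) := by
  constructor
  · rw [← convexJoin_singleton_segment, mem_convexJoin]
    rintro ⟨_, rfl, y, ⟨b, c, hb, hc, hbc, rfl⟩, a, d, ha, hd, had, rfl⟩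
    refine ⟨d * b, d * c, by positivity, by positivity, ?_, ?_⟩
    · rw [← mul_add, hbc]; linarith
    · obtain rfl : a = 1 - d := by linarith
      obtain rfl : b = 1 - c := by linarith
      module
  · rintro ⟨s, t, hs, ht, hst, rfl⟩
    have h := (convex_convexHull ℝ {A, B, C}).sum_mem (t := Finset.univ)
      (w := ![1 - s - t, s, t]) (z := ![A, B, C])
      (by simp [Fin.forall_fin_succ]; exact ⟨by linarith, hs, ht⟩)
      (by simp [Fin.sum_univ_three]; ring)
      (by
        intro i _
        apply subset_convexHull
        fin_cases i <;> simp)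
    convert! h using 1
    simp [Fin.sum_univ_three]
    module

/-- The area of a (possibly degenerate) triangle as half a determinant. -/
theorem volume_convexHull_triple (A B C : EuclideanSpace ℝ (Fin 2)) :
    volume (convexHull ℝ {A, B, C}) = ENNReal.ofReal (|planeDet (B - A) (C - A)| / 2) := by
  let f := Matrix.toLpLin 2 2 !![(B - A) 0, (C - A) 0; (B - A) 1, (C - A) 1]
  have hf (x : EuclideanSpace ℝ (Fin 2)) : f x = x 0 • (B - A) + x 1 • (C - A) := by
    ext i
    fin_cases i <;>
      simp [f, Matrix.toLpLin_apply, dotProduct, Fin.sum_univ_two] <;> ring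
  have himage : convexHull ℝ {A, B, C} = (A + ·) ''
      (f '' {x : EuclideanSpace ℝ (Fin 2) | 0 ≤ x 0 ∧ 0 ≤ x 1 ∧ x 0 + x 1 ≤ 1}) := by
    ext x
    rw [mem_convexHull_triple_iff, Set.image_image]
    constructor
    · rintro ⟨s, t, hs, ht, hst, rfl⟩
      exact ⟨!₂[s, t], ⟨by simpa using hs, by simpa using ht, by simpa using hst⟩, by simp [hf]⟩
    · rintro ⟨y, ⟨h0, h1, h2⟩, rfl⟩
      exact ⟨y 0, y 1, h0, h1, h2, by simp [hf]⟩
  have hdet : LinearMap.det f = planeDet (B - A) (C - A) := by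
    rw [LinearMap.det_toLpLin, Matrix.det_fin_two_of, planeDet]
    ring
  rw [himage, Set.image_add_left, measure_preimage_add, Measure.addHaar_image_linearMap, hdet,
    volume_standard_triangle, ← ENNReal.ofReal_mul (abs_nonneg _), mul_one_div]

theorem mem_convexHull_triple_of_weights {E : Type*} [AddCommGroup E] [Module ℝ E]
    {A B C D P : E} {s t α β γ δ : ℝ} (hs : s ∈ Set.Icc (0 : ℝ) 1) (ht : 0 < t)
    (hP : (1 - s) • A + s • C = P) (hP' : (1 - t) • B + t • D = P)
    (hα : 0 ≤ α) (hγ : 0 ≤ γ) (hδ : 0 ≤ δ) (hsum : α + β + γ + δ = 1)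
    (hle : δ * (1 - t) ≤ β * t) :
    α • A + β • B + γ • C + δ • D ∈ convexHull ℝ {A, B, C} := by
  obtain ⟨k, rfl⟩ : ∃ k, δ = k * t := ⟨δ / t, by field_simp⟩
  have hk : 0 ≤ k := nonneg_of_mul_nonneg_left hδ ht
  have hβ : k * (1 - t) ≤ β := le_of_mul_le_mul_right (by linarith) ht
  have hks : 0 ≤ k * (1 - s) := mul_nonneg hk (sub_nonneg.2 hs.2)
  have hks' : 0 ≤ k * s := mul_nonneg hk hs.1
  refine mem_convexHull_triple_iff.2
    ⟨β - k * (1 - t), γ + k * s, by linarith, by linarith, by linarith, ?_⟩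
  obtain rfl : α = 1 - β - γ - k * t := by linarith
  linear_combination (norm := module) k • (hP'.trans hP.symm)

theorem convexHull_quadruple_eq_union {E : Type*} [AddCommGroup E] [Module ℝ E]
    {A B C D P : E} (hAC : Wbtw ℝ A P C) (hBD : Sbtw ℝ B P D) :
    convexHull ℝ {A, B, C, D} = convexHull ℝ {A, B, C} ∪ convexHull ℝ {A, D, C} := by
  apply subset_antisymm
  · obtain ⟨s, ⟨hs0, hs1⟩, hs⟩ := hAC
    obtain ⟨t, ⟨ht0, ht1⟩, ht⟩ := sbtw_iff_mem_image_Ioo_and_ne.1 hBD |>.1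
    rw [AffineMap.lineMap_apply_module] at hs ht
    intro x hx
    rw [convexHull_insert (by simp), convexJoin_comm, mem_convexJoin] at hx
    simp only [Set.mem_singleton_iff, exists_eq_left] at hx
    obtain ⟨y, hy, a, d, ha, hd, had, rfl⟩ := hx
    obtain ⟨u, v, hu, hv, huv, rfl⟩ := mem_convexHull_triple_iff.1 hy
    have hcombo : a • (B + (u • (C - B) + v • (D - B))) + d • A
        = d • A + (a * (1 - u - v)) • B + (a * u) • C + (a * v) • D := by module
    rw [hcombo]
    have hw : 0 ≤ a * (1 - u - v) := mul_nonneg ha (by linarith)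
    rcases le_total (a * v * (1 - t)) (a * (1 - u - v) * t) with h | h
    · exact Or.inl <| mem_convexHull_triple_of_weights ⟨hs0, hs1⟩ ht0 hs ht hd
        (by positivity) (by positivity) (by linarith) h
    · have h' := mem_convexHull_triple_of_weights (D := B) (B := D) (t := 1 - t)
        (α := d) (β := a * v) (γ := a * u) (δ := a * (1 - u - v))
        ⟨hs0, hs1⟩ (sub_pos.2 ht1) hs (by rw [← ht]; module) hd (by positivity) hw (by linarith)
        (by linarith)
      refine Or.inr ?_
      convert! h' using 1
      abel
  · refine Set.union_subset (convexHull_mono ?_) (convexHull_mono ?_) <;>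
    · intro x
      simp only [Set.mem_insert_iff, Set.mem_singleton_iff]
      tauto

/-- The diagonals of a convex quadrilateral meet in an interior point of both. -/
theorem exists_sbtw_sbtw_of_sOppSide {E : Type*} [AddCommGroup E] [Module ℝ E]
    {A B C D : E}
    (hBD : line[ℝ, A, C].SOppSide B D) (hAC : line[ℝ, B, D].SOppSide A C) :
    ∃ P, Sbtw ℝ A P C ∧ Sbtw ℝ B P D := by
  obtain ⟨P, hP, hBPD⟩ := hBD.exists_sbtw
  obtain ⟨Q, hQ, hAQC⟩ := hAC.exists_sbtw
  have hQ' : Q ∈ line[ℝ, A, C] := hAQC.wbtw.mem_affineSpan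
  obtain ⟨t, -, rfl⟩ := hBPD.wbtw
  obtain ⟨m, rfl⟩ := mem_affineSpan_pair_iff_exists_lineMap_eq.1 hQ
  by_cases h : t = m
  · subst h
    exact ⟨_, hAQC, hBPD⟩
  · have hmt : m - t ≠ 0 := sub_ne_zero.2 (Ne.symm h)
    refine absurd ?_ hBD.left_notMem
    convert! AffineMap.lineMap_mem (-t / (m - t)) hP hQ' using 1
    obtain ⟨k, hk⟩ : ∃ k, k = -t / (m - t) := ⟨_, rfl⟩
    have hkt : k * (m - t) = -t := by rw [hk]; field_simp
    rw [← hk]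
    simp only [AffineMap.lineMap_apply_module]
    linear_combination (norm := module) hkt • (B - D)

theorem volume_convexHull_inter_eq_zero_of_sOppSide {A B C D : EuclideanSpace ℝ (Fin 2)}
    (hBD : line[ℝ, A, C].SOppSide B D) :
    volume (convexHull ℝ {A, B, C} ∩ convexHull ℝ {A, D, C}) = 0 := by
  have hne : line[ℝ, A, C] ≠ ⊤ := fun h ↦ hBD.left_notMem (h ▸ AffineSubspace.mem_top _ _ _)
  refine measure_mono_null ?_ (Measure.addHaar_affineSubspace volume _ hne)
  have hside {X x : EuclideanSpace ℝ (Fin 2)} (hx : x ∈ convexHull ℝ {A, X, C}) :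
      line[ℝ, A, C].WSameSide x X := by
    obtain ⟨p, q, hp, -, -, rfl⟩ := mem_convexHull_triple_iff.1 hx
    convert! AffineSubspace.wSameSide_smul_vsub_vadd_left X (left_mem_affineSpan_pair ℝ A C)
      (AffineMap.lineMap_mem_affineSpan_pair q A C) hp using 1
    simp only [AffineMap.lineMap_apply_module, vsub_eq_sub, vadd_eq_add]
    module
  rintro x ⟨hx, hx'⟩
  by_contra hmem
  exact ((hside hx).symm.trans (hside hx') hmem).not_sOppSide hBD

theorem planeDet_abs_add_abs {A B C D P : EuclideanSpace ℝ (Fin 2)} (hAC : Wbtw ℝ A P C)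
    (hBD : Sbtw ℝ B P D) :
    |planeDet (B - A) (C - A)| + |planeDet (D - A) (C - A)| = |planeDet (D - B) (C - A)| := by
  obtain ⟨s, -, hs⟩ := hAC
  obtain ⟨t, ⟨ht0, ht1⟩, ht⟩ := sbtw_iff_mem_image_Ioo_and_ne.1 hBD |>.1
  rw [AffineMap.lineMap_apply_module] at hs ht
  have h0 := congrArg (· 0) (hs.trans ht.symm)
  have h1 := congrArg (· 1) (hs.trans ht.symm)
  simp only [PiLp.add_apply, PiLp.smul_apply, smul_eq_mul] at h0 h1
  have hB : planeDet (B - A) (C - A) = -t * planeDet (D - B) (C - A) := by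
    simp only [planeDet, PiLp.sub_apply]
    linear_combination (A 1 - C 1) * h0 - (A 0 - C 0) * h1
  have hD : planeDet (D - A) (C - A) = (1 - t) * planeDet (D - B) (C - A) := by
    simp only [planeDet, PiLp.sub_apply]
    linear_combination (A 1 - C 1) * h0 - (A 0 - C 0) * h1
  rw [hB, hD, abs_mul, abs_mul, abs_neg, abs_of_pos ht0, abs_of_pos (sub_pos.2 ht1)]
  ring

/-- The area of a convex quadrilateral is half the determinant of its diagonals. -/
theorem volume_convexHull_quadruple {A B C D : EuclideanSpace ℝ (Fin 2)}
    (hBD : line[ℝ, A, C].SOppSide B D) (hAC : line[ℝ, B, D].SOppSide A C) :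
    volume (convexHull ℝ {A, B, C, D}) = ENNReal.ofReal (|planeDet (D - B) (C - A)| / 2) := by
  obtain ⟨P, hAPC, hBPD⟩ := exists_sbtw_sbtw_of_sOppSide hBD hAC
  have hmeas : MeasurableSet (convexHull ℝ {A, D, C}) :=
    ((Set.toFinite {A, D, C}).isCompact_convexHull ℝ).measurableSet
  rw [convexHull_quadruple_eq_union hAPC.wbtw hBPD,
    measure_union₀ hmeas.nullMeasurableSet (volume_convexHull_inter_eq_zero_of_sOppSide hBD),
    volume_convexHull_triple, volume_convexHull_triple,
    ← ENNReal.ofReal_add (by positivity) (by positivity), ← add_div,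
    planeDet_abs_add_abs hAPC.wbtw hBPD]

/-- Bretschneider's formula, in terms of the sides and diagonals. -/
theorem four_mul_planeDet_sq (A B C D : EuclideanSpace ℝ (Fin 2)) :
    4 * planeDet (D - B) (C - A) ^ 2 = 4 * (dist A C * dist B D) ^ 2
      - (dist A B ^ 2 - dist B C ^ 2 + dist C D ^ 2 - dist D A ^ 2) ^ 2 := by
  have hd (X Y : EuclideanSpace ℝ (Fin 2)) :
      dist X Y ^ 2 = (X 0 - Y 0) ^ 2 + (X 1 - Y 1) ^ 2 := by
    rw [EuclideanSpace.dist_sq_eq, Fin.sum_univ_two, Real.dist_eq, Real.dist_eq, sq_abs, sq_abs]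
  rw [mul_pow]
  simp only [hd, planeDet, PiLp.sub_apply]
  ring


/-- Brahmagupta's formula for the area of a convex cyclic quadrilateral. -/
theorem brahmagupta_formula
    (A B C D : EuclideanSpace ℝ (Fin 2))
    (hdist : A ≠ B ∧ A ≠ C ∧ A ≠ D ∧ B ≠ C ∧ B ≠ D ∧ C ≠ D)
    (hcyclic : EuclideanGeometry.Cospherical ({A, B, C, D} : Set (EuclideanSpace ℝ (Fin 2))))
    (hBD : (affineSpan ℝ ({A, C} : Set (EuclideanSpace ℝ (Fin 2)))).SOppSide B D)
    (hAC : (affineSpan ℝ ({B, D} : Set (EuclideanSpace ℝ (Fin 2)))).SOppSide A C) :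
    (volume (convexHull ℝ ({A, B, C, D} : Set (EuclideanSpace ℝ (Fin 2))))).toReal
      = Real.sqrt
          (((dist A B + dist B C + dist C D + dist D A) / 2 - dist A B)
           * ((dist A B + dist B C + dist C D + dist D A) / 2 - dist B C)
           * ((dist A B + dist B C + dist C D + dist D A) / 2 - dist C D)
           * ((dist A B + dist B C + dist C D + dist D A) / 2 - dist D A)) := by
  obtain ⟨P, hAPC, hBPD⟩ := exists_sbtw_sbtw_of_sOppSide hBD hAC
  have hptolemy := mul_dist_add_mul_dist_eq_mul_dist_of_cospherical hcyclic
    hAPC.angle₁₂₃_eq_pi hBPD.angle₁₂₃_eq_pi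
  have hdet := four_mul_planeDet_sq A B C D
  rw [← hptolemy] at hdet
  rw [volume_convexHull_quadruple hBD hAC, ENNReal.toReal_ofReal (by positivity), eq_comm,
    ← Real.sqrt_sq (show 0 ≤ |planeDet (D - B) (C - A)| / 2 by positivity), div_pow, sq_abs]
  congr 1
  linear_combination -hdet / 16
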